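/- arXiv:2307.16862 — 2 statements merged into one kernel-verified Lean document; each statement's English description precedes it below -/
import Mathlib

section
/- If A, B ∈ 𝕊ⁿ are symmetric positive definite matrices, then A ⊗ₛ B ∈ ℝ^{n̄ × n̄} is symmetric positive definite. -/
open Matrix

noncomputable section

/-- `n̄ = n(n+1)/2`, the dimension of the space of symmetric `n × n` matrices. -/
def triDim (n : ℕ) : ℕ := n * (n + 1) / 2

/-- The (0-based) row/column pair `(r(j), c(j))` of the `j`-th position in the
lexicographic (left-to-right, top-to-bottom) enumeration of the on-or-above-diagonal
positions of an `n × n` matrix. -/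
def rcPair : ℕ → ℕ → ℕ × ℕ
  | 0, _ => (0, 0)
  | (m + 1), j =>
      if j < m + 1 then (0, j)
      else ((rcPair m (j - (m + 1))).1 + 1, (rcPair m (j - (m + 1))).2 + 1)

/-- The orthonormal basis `E_j` of the space of symmetric `n × n` matrices:
`E_j = e_{r(j)} e_{c(j)}ᵀ` if `r(j) = c(j)`, and
`E_j = (√2/2) (e_{r(j)} e_{c(j)}ᵀ + e_{c(j)} e_{r(j)}ᵀ)` if `r(j) < c(j)`. -/
def symBasis (n : ℕ) (j : Fin (triDim n)) : Matrix (Fin n) (Fin n) ℝ :=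
  if (rcPair n j).1 = (rcPair n j).2 then
    Matrix.of fun a b : Fin n =>
      if (a : ℕ) = (rcPair n j).1 ∧ (b : ℕ) = (rcPair n j).2 then (1 : ℝ) else 0
  else
    Matrix.of fun a b : Fin n =>
      if ((a : ℕ) = (rcPair n j).1 ∧ (b : ℕ) = (rcPair n j).2) ∨
          ((a : ℕ) = (rcPair n j).2 ∧ (b : ℕ) = (rcPair n j).1) then
        Real.sqrt 2 / 2
      else 0

/-- Column-stacking vectorization `vec : ℝ^{m×n} → ℝ^{nm}`: `vec(A)_{j·m + i} = A_{i,j}`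
(0-based), realized through `finProdFinEquiv (j, i) = j * m + i`. -/
def mvec {m n : ℕ} (A : Matrix (Fin m) (Fin n) ℝ) : Fin (n * m) → ℝ :=
  fun k => A (finProdFinEquiv.symm k).2 (finProdFinEquiv.symm k).1

/-- The matrix `W_n ∈ ℝ^{n̄ × n²}` whose `j`-th row is `vec(E_j)ᵀ`. -/
def Wmat (n : ℕ) : Matrix (Fin (triDim n)) (Fin (n * n)) ℝ :=
  Matrix.of fun j k => mvec (symBasis n j) k

/-- The Kronecker product on `Fin`-indexed matrices, with the standard flattening
`(A ⊗ B)_{(i·p + k, j·q + l)} = A_{i,j} B_{k,l}`. -/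
def kron {m n p q : ℕ} (A : Matrix (Fin m) (Fin n) ℝ) (B : Matrix (Fin p) (Fin q) ℝ) :
    Matrix (Fin (m * p)) (Fin (n * q)) ℝ :=
  Matrix.reindex finProdFinEquiv finProdFinEquiv (Matrix.kroneckerMap (· * ·) A B)

/-- The symmetric Kronecker product `A ⊗ₛ B = W_m (A ⊗ B) W_nᵀ ∈ ℝ^{m̄ × n̄}`
of rectangular matrices `A, B ∈ ℝ^{m×n}`. -/
def skron {m n : ℕ} (A B : Matrix (Fin m) (Fin n) ℝ) :
    Matrix (Fin (triDim m)) (Fin (triDim n)) ℝ :=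
  Wmat m * kron A B * (Wmat n)ᵀ

/-- The Frobenius inner product `⟨A, B⟩_F = trace(Aᵀ B)`. -/
def frobInner {m n : ℕ} (A B : Matrix (Fin m) (Fin n) ℝ) : ℝ :=
  (Aᵀ * B).trace

/-- Symmetric vectorization `svec(P)_j = ⟨P, E_j⟩_F`. -/
def svec {n : ℕ} (P : Matrix (Fin n) (Fin n) ℝ) : Fin (triDim n) → ℝ :=
  fun j => frobInner P (symBasis n j)

/-- The symmetric part `π(A) = (A + Aᵀ)/2`. -/
def symPart {n : ℕ} (A : Matrix (Fin n) (Fin n) ℝ) : Matrix (Fin n) (Fin n) ℝ :=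
  (1 / 2 : ℝ) • (A + Aᵀ)

/-- The symmetric Kronecker sum `A ⊕ₛ B = A ⊗ₛ I + I ⊗ₛ B`. -/
def skronSum {n : ℕ} (A B : Matrix (Fin n) (Fin n) ℝ) :
    Matrix (Fin (triDim n)) (Fin (triDim n)) ℝ :=
  skron A 1 + skron 1 B

/-- A vector `x ∈ ℝⁿ` regarded as an `n × 1` matrix. -/
def colVec {n : ℕ} (x : Fin n → ℝ) : Matrix (Fin n) (Fin 1) ℝ :=
  Matrix.of fun i _ => x i

theorem triDim_succ (n : ℕ) : triDim (n + 1) = triDim n + (n + 1) := by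
  unfold triDim
  rw [show (n + 1) * (n + 1 + 1) = n * (n + 1) + (n + 1) * 2 by ring,
    Nat.add_mul_div_right _ _ two_pos]

theorem rcPair_fst_le_snd (n j : ℕ) : (rcPair n j).1 ≤ (rcPair n j).2 := by
  induction n generalizing j with
  | zero => simp [rcPair]
  | succ n ih =>
    have := ih (j - (n + 1))
    unfold rcPair
    split_ifs <;> simp_all

theorem rcPair_snd_lt {n j : ℕ} (hj : j < triDim n) : (rcPair n j).2 < n := by
  induction n generalizing j with
  | zero => simp [triDim] at hj
  | succ n ih =>
    rw [triDim_succ] at hj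
    unfold rcPair
    split_ifs with h
    · exact h
    · have := ih (j := j - (n + 1)) (by lia)
      simpa using this

theorem rcPair_injOn (n : ℕ) : Set.InjOn (rcPair n) (Set.Iio (triDim n)) := by
  induction n with
  | zero => simp [triDim]
  | succ n ih =>
    intro i hi j hj hij
    rw [Set.mem_Iio, triDim_succ] at hi hj
    unfold rcPair at hij
    split_ifs at hij with h₁ h₂ h₂
    · exact (Prod.ext_iff.1 hij).2
    · simp at hij
    · simp at hij
    · simp only [Prod.mk.injEq, add_left_inj] at hij
      have := @ih (i - (n + 1)) (by rw [Set.mem_Iio]; lia) (j - (n + 1))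
        (by rw [Set.mem_Iio]; lia) (Prod.ext hij.1 hij.2)
      lia

theorem symBasis_apply_rcPair_ne_zero_iff {n : ℕ} (j k : Fin (triDim n)) {a b : Fin n}
    (ha : (a : ℕ) = (rcPair n j).1) (hb : (b : ℕ) = (rcPair n j).2) :
    symBasis n k a b ≠ 0 ↔ k = j := by
  have hinj : k = j ↔ (rcPair n j).1 = (rcPair n k).1 ∧ (rcPair n j).2 = (rcPair n k).2 := by
    refine ⟨by rintro rfl; simp, fun h => Fin.ext ?_⟩
    exact rcPair_injOn n k.2 j.2 (Prod.ext h.1.symm h.2.symm)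
  have hj := rcPair_fst_le_snd n j
  have hk := rcPair_fst_le_snd n k
  rw [hinj]
  unfold symBasis
  split_ifs with h
  · simp [ha, hb]
  · simp only [of_apply, ha, hb, ne_eq, ite_eq_right_iff, Classical.not_imp]
    have : ¬ Real.sqrt 2 / 2 = 0 := by positivity
    simp only [this, not_false_eq_true, and_true]
    lia

theorem Wmat_vecMul_injective (n : ℕ) : Function.Injective (Wmat n).vecMul := by
  rw [Matrix.vecMul_injective_iff, Fintype.linearIndependent_iff]
  intro x hx j
  have hc := rcPair_snd_lt j.2
  have hr := (rcPair_fst_le_snd n j).trans_lt hc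
  have key := symBasis_apply_rcPair_ne_zero_iff (n := n) j
    (a := ⟨_, hr⟩) (b := ⟨_, hc⟩) (ha := rfl) (hb := rfl)
  have h := congrFun hx (finProdFinEquiv (⟨_, hc⟩, ⟨_, hr⟩))
  simp only [Finset.sum_apply, Pi.smul_apply, Matrix.row, Wmat, mvec, of_apply,
    Equiv.symm_apply_apply, smul_eq_mul, Pi.zero_apply] at h
  rw [Finset.sum_eq_single j (fun k _ hk => by
    rw [not_not.1 (mt (key k).1 hk), mul_zero]) (by simp)] at h
  exact (mul_eq_zero.1 h).resolve_right ((key j).2 rfl)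

theorem kron_posDef {m n : ℕ} {A : Matrix (Fin m) (Fin m) ℝ} {B : Matrix (Fin n) (Fin n) ℝ}
    (hA : A.PosDef) (hB : B.PosDef) : (kron A B).PosDef :=
  (hA.kronecker hB).submatrix finProdFinEquiv.symm.injective

/-- if `A, B` are symmetric positive definite, then so is `A ⊗ₛ B`. -/
theorem skron_posDef (n : ℕ) (A B : Matrix (Fin n) (Fin n) ℝ)
    (hA : A.PosDef) (hB : B.PosDef) :
    (skron A B).PosDef := by
  have h := (kron_posDef hA hB).mul_mul_conjTranspose_same (Wmat_vecMul_injective n)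
  rwa [conjTranspose_eq_transpose_of_trivial] at h
end
end

section
/- Partial eigenstructure of the symmetric Kronecker sum: let A, B ∈ ℝ^{n×n} and suppose x, y ∈ ℝⁿ are nonzero vectors with A x = λ₁ x, B x = μ₁ x, A y = λ₂ y, B y = μ₂ y for real scalars λ₁, μ₁, λ₂, μ₂. Then x ⊗ₛ y is a nonzero vector in ℝ^{n̄} and (A ⊕ₛ B)(x ⊗ₛ y) = ½ (λ₁ + μ₁ + λ₂ + μ₂)(x ⊗ₛ y). In particular, taking B = A: if A x = λ x and A y = μ y with x, y ≠ 0, then (A ⊕ₛ A)(x ⊗ₛ y) = (λ + μ)(x ⊗ₛ y). -/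
open Matrix

noncomputable section

open Finset in
theorem sum_rcPair {M : Type*} [AddCommMonoid M] (n : ℕ) (F : ℕ → ℕ → M) :
    ∑ j ∈ range (triDim n), F (rcPair n j).1 (rcPair n j).2 =
      ∑ r ∈ range n, ∑ c ∈ Ico r n, F r c := by
  induction n generalizing F with
  | zero => simp [triDim]
  | succ m ih =>
    have hdim : triDim (m + 1) = (m + 1) + triDim m := by
      unfold triDim
      rw [show (m + 1) * (m + 1 + 1) = m * (m + 1) + (m + 1) * 2 by ring,
        Nat.add_mul_div_right _ _ two_pos, add_comm]
    rw [hdim, sum_range_add, sum_range_succ' (fun r => ∑ c ∈ Ico r (m + 1), F r c), add_comm]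
    congr 1
    · simp only [rcPair, add_lt_iff_neg_left, not_lt_zero, if_false, add_tsub_cancel_left]
      rw [ih fun r c => F (r + 1) (c + 1)]
      exact sum_congr rfl fun r _ => sum_Ico_add' (fun c => F (r + 1) c) r m 1
    · rw [← range_eq_Ico]
      refine sum_congr rfl fun j hj => ?_
      simp [rcPair, mem_range.1 hj]

/-- The `(a, b)` entry of the symmetric basis matrix attached to the position `(r, c)`. -/
def symEntry (r c a b : ℕ) : ℝ :=
  if (a = r ∧ b = c) ∨ (a = c ∧ b = r) then (if r = c then 1 else Real.sqrt 2 / 2) else 0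

theorem symEntry_swap (r c a b : ℕ) : symEntry r c b a = symEntry r c a b := by
  simp only [symEntry, and_comm, or_comm]

theorem symBasis_apply {n : ℕ} (j : Fin (triDim n)) (a b : Fin n) :
    symBasis n j a b = symEntry (rcPair n j).1 (rcPair n j).2 a b := by
  unfold symBasis symEntry
  split_ifs with h <;> grind [Matrix.of_apply]

open Finset in
theorem sum_symEntry_mul {n a b : ℕ} (hab : a ≤ b) (hb : b < n) (c d : ℕ) :
    ∑ r ∈ range n, ∑ s ∈ Ico r n, symEntry r s a b * symEntry r s c d =
      symEntry a b a b * symEntry a b c d := by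
  rw [sum_eq_single_of_mem a (mem_range.2 (hab.trans_lt hb)),
    sum_eq_single_of_mem b (mem_Ico.2 ⟨hab, hb⟩)]
  · intro s hs hne
    have := mem_Ico.1 hs
    rw [symEntry, if_neg (by omega), zero_mul]
  · intro r _ hne
    refine sum_eq_zero fun s hs => ?_
    have := mem_Ico.1 hs
    rw [symEntry, if_neg (by omega), zero_mul]

theorem symEntry_self_mul (a b c d : ℕ) :
    symEntry a b a b * symEntry a b c d =
      (1 / 2 : ℝ) * ((if a = c ∧ b = d then 1 else 0) + if a = d ∧ b = c then 1 else 0) := by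
  have h := Real.mul_self_sqrt (zero_le_two (α := ℝ))
  unfold symEntry
  split_ifs <;> first | omega | grind

/-- The sum over `j` of `E_j ⊗ E_j` is the orthogonal projection onto symmetric matrices. -/
theorem sum_symBasis_mul {n : ℕ} (a b c d : Fin n) :
    ∑ j, symBasis n j a b * symBasis n j c d =
      (1 / 2 : ℝ) * ((if a = c ∧ b = d then 1 else 0) + if a = d ∧ b = c then 1 else 0) := by
  simp only [symBasis_apply]
  rw [Fin.sum_univ_eq_sum_range (fun j => symEntry (rcPair n j).1 (rcPair n j).2 a b *
      symEntry (rcPair n j).1 (rcPair n j).2 c d),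
    sum_rcPair n fun r s => symEntry r s a b * symEntry r s c d]
  rcases le_total (a : ℕ) b with hab | hab
  · rw [sum_symEntry_mul hab b.2, symEntry_self_mul]
    simp only [Fin.ext_iff]
  · simp only [fun r s => symEntry_swap r s b a]
    rw [sum_symEntry_mul hab a.2, symEntry_self_mul]
    simp only [Fin.ext_iff, and_comm, add_comm]

/-- The permutation of `Fin (n * n)` exchanging the two tensor factors. -/
def swapIdx (n : ℕ) : Fin (n * n) ≃ Fin (n * n) :=
  finProdFinEquiv.symm.trans ((Equiv.prodComm _ _).trans finProdFinEquiv)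

theorem swapIdx_finProdFinEquiv {n : ℕ} (a b : Fin n) :
    swapIdx n (finProdFinEquiv (a, b)) = finProdFinEquiv (b, a) := by
  simp [swapIdx]

/-- The commutation matrix `K` with `K (x ⊗ y) = y ⊗ x`. -/
def commMat (n : ℕ) : Matrix (Fin (n * n)) (Fin (n * n)) ℝ :=
  (1 : Matrix (Fin (n * n)) (Fin (n * n)) ℝ).submatrix (swapIdx n) id

theorem commMat_mul {n : ℕ} {ι : Type*} (M : Matrix (Fin (n * n)) ι ℝ) :
    commMat n * M = M.submatrix (swapIdx n) id := by
  simpa [commMat] using (submatrix_mul 1 M (swapIdx n) id id Function.bijective_id).symm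

theorem mul_commMat {n : ℕ} {ι : Type*} (M : Matrix ι (Fin (n * n)) ℝ) :
    M * commMat n = M.submatrix id (swapIdx n).symm := by
  have h : commMat n =
      (1 : Matrix (Fin (n * n)) (Fin (n * n)) ℝ).submatrix id (swapIdx n).symm := by
    ext i j
    simp [commMat, one_apply, Equiv.eq_symm_apply]
  rw [h]
  simpa using (submatrix_mul M 1 id id (swapIdx n).symm Function.bijective_id).symm

theorem commMat_one : commMat 1 = 1 := by
  ext i j
  have : Subsingleton (Fin (1 * 1)) := inferInstanceAs (Subsingleton (Fin 1))
  simp [commMat, one_apply, eq_iff_true_of_subsingleton]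

theorem commMat_mul_kron {m n : ℕ} (C D : Matrix (Fin m) (Fin n) ℝ) :
    commMat m * kron C D = kron D C * commMat n := by
  rw [commMat_mul, mul_commMat]
  ext i j
  simp [kron, swapIdx, mul_comm]

theorem Wmat_apply {n : ℕ} (j : Fin (triDim n)) (a b : Fin n) :
    Wmat n j (finProdFinEquiv (a, b)) = symBasis n j b a := by
  simp only [Wmat, mvec, of_apply, Equiv.symm_apply_apply]

theorem commMat_mul_Wmat_transpose (n : ℕ) : commMat n * (Wmat n)ᵀ = (Wmat n)ᵀ := by
  rw [commMat_mul]
  ext i j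
  obtain ⟨⟨a, b⟩, rfl⟩ := finProdFinEquiv.surjective i
  simp only [submatrix_apply, swapIdx_finProdFinEquiv, transpose_apply, id, Wmat_apply,
    symBasis_apply, symEntry_swap _ _ (a : ℕ) b]

theorem Wmat_transpose_mul_Wmat (n : ℕ) :
    (Wmat n)ᵀ * Wmat n = (1 / 2 : ℝ) • (1 + commMat n) := by
  ext i j
  obtain ⟨⟨a, b⟩, rfl⟩ := finProdFinEquiv.surjective i
  obtain ⟨⟨c, d⟩, rfl⟩ := finProdFinEquiv.surjective j
  simp only [mul_apply, transpose_apply, Wmat_apply, sum_symBasis_mul, Matrix.smul_apply, Matrix.add_apply,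
    commMat, submatrix_apply, swapIdx_finProdFinEquiv, id, one_apply, smul_eq_mul,
    EmbeddingLike.apply_eq_iff_eq, Prod.mk.injEq, and_comm]

theorem kron_mul_kron {m n p : ℕ} (A B : Matrix (Fin m) (Fin n) ℝ)
    (C D : Matrix (Fin n) (Fin p) ℝ) :
    kron A B * kron C D = kron (A * C) (B * D) := by
  unfold kron
  simp only [reindex_apply, submatrix_mul_equiv]
  congr 1
  exact (mul_kronecker_mul A C B D).symm

theorem skron_mul_skron {m n p : ℕ} (A B : Matrix (Fin m) (Fin n) ℝ)
    (C D : Matrix (Fin n) (Fin p) ℝ) :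
    skron A B * skron C D = (1 / 2 : ℝ) • (skron (A * C) (B * D) + skron (A * D) (B * C)) := by
  have h : skron A B * skron C D =
      Wmat m * (kron A B * (((Wmat n)ᵀ * Wmat n) * kron C D) * (Wmat p)ᵀ) := by
    simp only [skron, Matrix.mul_assoc]
  rw [h, Wmat_transpose_mul_Wmat, Matrix.smul_mul, Matrix.add_mul, Matrix.one_mul,
    commMat_mul_kron]
  simp only [Matrix.mul_smul, Matrix.smul_mul, Matrix.mul_add, Matrix.add_mul,
    ← Matrix.mul_assoc, kron_mul_kron, skron]
  simp only [Matrix.mul_assoc, commMat_mul_Wmat_transpose]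

theorem skron_comm {m n : ℕ} (A B : Matrix (Fin m) (Fin n) ℝ) : skron A B = skron B A := by
  have hW : Wmat m * commMat m = Wmat m := by
    rw [mul_commMat]
    ext j i
    obtain ⟨⟨a, b⟩, rfl⟩ := finProdFinEquiv.surjective i
    simp [swapIdx, Wmat_apply, symBasis_apply, symEntry_swap _ _ (a : ℕ) b]
  calc skron A B = Wmat m * commMat m * kron A B * (Wmat n)ᵀ := by rw [hW, skron]
    _ = Wmat m * kron B A * (commMat n * (Wmat n)ᵀ) := by
      rw [Matrix.mul_assoc (Wmat m), commMat_mul_kron]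
      simp only [Matrix.mul_assoc]
    _ = skron B A := by rw [commMat_mul_Wmat_transpose, skron]

theorem smul_skron {m n : ℕ} (t : ℝ) (A B : Matrix (Fin m) (Fin n) ℝ) :
    skron (t • A) B = t • skron A B := by
  have : kron (t • A) B = t • kron A B := by
    ext i j
    simp [kron, mul_assoc]
  rw [skron, this, Matrix.mul_smul, Matrix.smul_mul, skron]

theorem mul_colVec {m n : ℕ} (A : Matrix (Fin m) (Fin n) ℝ) (x : Fin n → ℝ) :
    A * colVec x = colVec (A *ᵥ x) := rfl

theorem colVec_smul {n : ℕ} (t : ℝ) (x : Fin n → ℝ) : colVec (t • x) = t • colVec x := rfl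

theorem skron_colVec_ne_zero {n : ℕ} {x y : Fin n → ℝ} (hx : x ≠ 0) (hy : y ≠ 0) :
    skron (colVec x) (colVec y) ≠ 0 := by
  intro h
  have h0 : (Wmat n)ᵀ * skron (colVec x) (colVec y) * Wmat 1 =
      ((Wmat n)ᵀ * Wmat n) * kron (colVec x) (colVec y) * ((Wmat 1)ᵀ * Wmat 1) := by
    simp only [skron, Matrix.mul_assoc]
  have hid : (Wmat 1)ᵀ * Wmat 1 = (1 : Matrix (Fin (1 * 1)) (Fin (1 * 1)) ℝ) := by
    rw [Wmat_transpose_mul_Wmat, commMat_one, ← two_smul ℝ, smul_smul]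
    norm_num
  rw [h, hid, Wmat_transpose_mul_Wmat, Matrix.smul_mul, Matrix.add_mul, commMat_mul_kron,
    commMat_one] at h0
  have hsym (a b : Fin n) : x a * y b + y a * x b = 0 := by
    have := congrFun₂ h0 (finProdFinEquiv (a, b)) (finProdFinEquiv (0, 0))
    simp [kron, colVec] at this
    linarith
  obtain ⟨a, ha⟩ := Function.ne_iff.1 hx
  rw [Pi.zero_apply] at ha
  have hya : y a = 0 := by
    have := hsym a a
    have : x a * y a = 0 := by linarith
    exact (mul_eq_zero.1 this).resolve_left ha
  refine hy (funext fun b => ?_)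
  have := hsym a b
  rw [hya, zero_mul, add_zero] at this
  exact (mul_eq_zero.1 this).resolve_left ha

theorem skronSum_mul_skron_colVec {n : ℕ} {A B : Matrix (Fin n) (Fin n) ℝ} {x y : Fin n → ℝ}
    {l₁ m₁ l₂ m₂ : ℝ} (hAx : A *ᵥ x = l₁ • x) (hBx : B *ᵥ x = m₁ • x)
    (hAy : A *ᵥ y = l₂ • y) (hBy : B *ᵥ y = m₂ • y) :
    skronSum A B * skron (colVec x) (colVec y) =
      ((1 / 2 : ℝ) * (l₁ + m₁ + l₂ + m₂)) • skron (colVec x) (colVec y) := by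
  rw [skronSum, skron_comm 1 B, Matrix.add_mul, skron_mul_skron, skron_mul_skron]
  simp only [Matrix.one_mul, mul_colVec, hAx, hBx, hAy, hBy, colVec_smul, smul_skron,
    skron_comm (colVec y) (colVec x)]
  module

/-- partial eigenstructure of the symmetric Kronecker sum:
if `A x = λ₁ x`, `B x = μ₁ x`, `A y = λ₂ y`, `B y = μ₂ y` with `x, y ≠ 0`, then
`x ⊗ₛ y ≠ 0` and `(A ⊕ₛ B)(x ⊗ₛ y) = ½(λ₁ + μ₁ + λ₂ + μ₂)(x ⊗ₛ y)`;
in particular, for `B = A`: `(A ⊕ₛ A)(x ⊗ₛ y) = (λ + μ)(x ⊗ₛ y)`. -/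
theorem skronSum_shared_eigenvector (n : ℕ) :
    (∀ (A B : Matrix (Fin n) (Fin n) ℝ) (x y : Fin n → ℝ), x ≠ 0 → y ≠ 0 →
      ∀ l₁ m₁ l₂ m₂ : ℝ, A.mulVec x = l₁ • x → B.mulVec x = m₁ • x →
        A.mulVec y = l₂ • y → B.mulVec y = m₂ • y →
        skron (colVec x) (colVec y) ≠ 0 ∧
        skronSum A B * skron (colVec x) (colVec y) =
          ((1 / 2 : ℝ) * (l₁ + m₁ + l₂ + m₂)) • skron (colVec x) (colVec y)) ∧
    (∀ (A : Matrix (Fin n) (Fin n) ℝ) (x y : Fin n → ℝ), x ≠ 0 → y ≠ 0 →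
      ∀ l m : ℝ, A.mulVec x = l • x → A.mulVec y = m • y →
        skronSum A A * skron (colVec x) (colVec y) =
          (l + m) • skron (colVec x) (colVec y)) := by
  refine ⟨fun A B x y hx hy l₁ m₁ l₂ m₂ hAx hBx hAy hBy => ⟨skron_colVec_ne_zero hx hy,
    skronSum_mul_skron_colVec hAx hBx hAy hBy⟩, fun A x y _ _ l m hAx hAy => ?_⟩
  rw [skronSum_mul_skron_colVec hAx hAx hAy hAy]
  congr 1
  ring
end
end
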